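/- arXiv:2312.13078 — 2 statements merged into one kernel-verified Lean document; each statement's English description precedes it below -/
import Mathlib

section
/- Let P = [0,a] × [0,1]^{n−1} be partitioned into adjacent boxes P_i = [a_{i−1}, a_i] × [0,1]^{n−1} with 0 = a₀ < a₁ < … < a_k = a, k ≥ 2. If f, g ∈ L¹(P) satisfy f, g > 0 a.e. and ∫_P f = ∫_P g, then there exists a C^∞ diffeomorphism Φ : P → P, equal to the identity in a neighborhood of ∂P, such that ∫_{P_i} f = ∫_{Φ(P_i)} g for all i = 1, …, k. -/
open MeasureTheory
open Set Filter Topology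

/-- Orientation preserving `C^∞` diffeomorphisms of the line supported in a compact subset of the
open interval `(p, q)`. -/
structure IsCompactlySupportedDiffeo (p q : ℝ) (ψ : ℝ → ℝ) : Prop where
  contDiff : ContDiff ℝ (⊤ : ℕ∞) ψ
  deriv_pos : ∀ s, 0 < deriv ψ s
  exists_eq_left : ∃ p' > p, ∀ s ≤ p', ψ s = s
  exists_eq_right : ∃ q' < q, ∀ s ≥ q', ψ s = s

namespace IsCompactlySupportedDiffeo

variable {p q p₁ q₁ : ℝ} {ψ ψ₁ ψ₂ : ℝ → ℝ}

lemma differentiable (h : IsCompactlySupportedDiffeo p q ψ) : Differentiable ℝ ψ :=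
  h.contDiff.differentiable (by simp)

lemma strictMono (h : IsCompactlySupportedDiffeo p q ψ) : StrictMono ψ :=
  strictMono_of_deriv_pos h.deriv_pos

lemma eq_of_le (h : IsCompactlySupportedDiffeo p q ψ) {s : ℝ} (hs : s ≤ p) : ψ s = s := by
  obtain ⟨p', hp', H⟩ := h.exists_eq_left
  exact H s (hs.trans hp'.le)

lemma eq_of_ge (h : IsCompactlySupportedDiffeo p q ψ) {s : ℝ} (hs : q ≤ s) : ψ s = s := by
  obtain ⟨q', hq', H⟩ := h.exists_eq_right
  exact H s (hq'.le.trans hs)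

lemma refl (p q : ℝ) : IsCompactlySupportedDiffeo p q (fun s ↦ s) where
  contDiff := contDiff_id
  deriv_pos s := by simp
  exists_eq_left := ⟨p + 1, by simp, fun _ _ ↦ rfl⟩
  exists_eq_right := ⟨q - 1, by simp, fun _ _ ↦ rfl⟩

lemma mono (h : IsCompactlySupportedDiffeo p q ψ) (hp : p₁ ≤ p) (hq : q ≤ q₁) :
    IsCompactlySupportedDiffeo p₁ q₁ ψ where
  contDiff := h.contDiff
  deriv_pos := h.deriv_pos
  exists_eq_left := by
    obtain ⟨p', hp', H⟩ := h.exists_eq_left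
    exact ⟨p', hp.trans_lt hp', H⟩
  exists_eq_right := by
    obtain ⟨q', hq', H⟩ := h.exists_eq_right
    exact ⟨q', hq'.trans_le hq, H⟩

lemma comp (h₂ : IsCompactlySupportedDiffeo p q ψ₂) (h₁ : IsCompactlySupportedDiffeo p q ψ₁) :
    IsCompactlySupportedDiffeo p q (ψ₂ ∘ ψ₁) where
  contDiff := h₂.contDiff.comp h₁.contDiff
  deriv_pos s := by
    rw [deriv_comp s (h₂.differentiable _) (h₁.differentiable _)]
    exact mul_pos (h₂.deriv_pos _) (h₁.deriv_pos _)
  exists_eq_left := by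
    obtain ⟨p', hp', H₁⟩ := h₁.exists_eq_left
    obtain ⟨p'', hp'', H₂⟩ := h₂.exists_eq_left
    refine ⟨min p' p'', lt_min hp' hp'', fun s hs ↦ ?_⟩
    rw [Function.comp, H₁ s (hs.trans (min_le_left _ _)), H₂ s (hs.trans (min_le_right _ _))]
  exists_eq_right := by
    obtain ⟨q', hq', H₁⟩ := h₁.exists_eq_right
    obtain ⟨q'', hq'', H₂⟩ := h₂.exists_eq_right
    refine ⟨max q' q'', max_lt hq' hq'', fun s hs ↦ ?_⟩
    rw [Function.comp, H₁ s ((le_max_left _ _).trans hs), H₂ s ((le_max_right _ _).trans hs)]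

lemma exists_add_near {u : ℝ} (hu : u ∈ Ioo p q) :
    ∃ ε > 0, ∀ v w, |v - u| < ε → |w - u| < ε →
      ∃ ψ, IsCompactlySupportedDiffeo p q ψ ∧ ψ v = w := by
  obtain ⟨hpu, huq⟩ := hu
  set R := min (u - p) (q - u) / 2 with hR
  have hR0 : 0 < R := half_pos (lt_min (by linarith) (by linarith))
  have hRp : R < u - p := by
    have := min_le_left (u - p) (q - u); linarith
  have hRq : R < q - u := by
    have := min_le_right (u - p) (q - u); linarith
  let β : ContDiffBump u := ⟨R / 2, R, by linarith, by linarith⟩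
  have hβ : ContDiff ℝ (⊤ : ℕ∞) β := β.contDiff
  have hβd : Differentiable ℝ β := hβ.differentiable (by simp)
  obtain ⟨C, hC⟩ := (hβ.continuous_deriv (by simp)).bounded_above_of_compact_support
    β.hasCompactSupport.deriv
  have hC0 : 0 ≤ C := (norm_nonneg _).trans (hC u)
  have hzero : ∀ s, R ≤ |s - u| → β s = 0 := fun s hs ↦ β.zero_of_le_dist hs
  refine ⟨min (R / 2) (1 / (2 * (C + 1))), by positivity, fun v w hv hw ↦ ?_⟩
  have hwv : |w - v| < 1 / (C + 1) := by
    have h1 := hv.trans_le (min_le_right _ _)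
    have h2 := hw.trans_le (min_le_right _ _)
    have h3 : 1 / (C + 1) = 1 / (2 * (C + 1)) + 1 / (2 * (C + 1)) := by field_simp; ring
    rw [h3]
    calc |w - v| = |(w - u) - (v - u)| := by ring_nf
      _ ≤ |w - u| + |v - u| := abs_sub _ _
      _ < _ := by linarith
  refine ⟨fun s ↦ s + (w - v) * β s, ⟨?_, fun s ↦ ?_, ?_, ?_⟩, ?_⟩
  · exact contDiff_id.add (contDiff_const.mul hβ)
  · have hd : deriv (fun s ↦ s + (w - v) * β s) s = 1 + (w - v) * deriv β s := by
      have := (hasDerivAt_id s).add ((hβd s).hasDerivAt.const_mul (w - v))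
      exact this.deriv
    rw [hd]
    have h1 : |(w - v) * deriv β s| < 1 := by
      rw [abs_mul]
      have h2 : |deriv β s| ≤ C := hC s
      calc |w - v| * |deriv β s| ≤ |w - v| * C := by gcongr
        _ ≤ 1 / (C + 1) * C := by gcongr
        _ < 1 := by rw [one_div_mul_eq_div, div_lt_one (by positivity)]; linarith
    linarith [(abs_lt.1 h1).1]
  · refine ⟨u - R, by linarith, fun s hs ↦ ?_⟩
    rw [hzero s (by rw [abs_sub_comm]; exact (by linarith : R ≤ u - s).trans (le_abs_self _))]
    simp
  · refine ⟨u + R, by linarith, fun s hs ↦ ?_⟩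
    rw [hzero s ((by linarith : R ≤ s - u).trans (le_abs_self _))]
    simp
  · have : β v = 1 := β.one_of_mem_closedBall (hv.trans_le (min_le_left _ _)).le
    simp [this]

lemma exists_map_eq {u v : ℝ} (hu : u ∈ Ioo p q) (hv : v ∈ Ioo p q) :
    ∃ ψ, IsCompactlySupportedDiffeo p q ψ ∧ ψ u = v := by
  refine isPreconnected_Ioo.induction₂'
    (fun u v ↦ ∃ ψ, IsCompactlySupportedDiffeo p q ψ ∧ ψ u = v) (fun x hx ↦ ?_) ?_ hu hv
  · obtain ⟨ε, hε, H⟩ := exists_add_near hx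
    filter_upwards [mem_nhdsWithin_of_mem_nhds (Metric.ball_mem_nhds x hε)] with y hy
    have hy' : |y - x| < ε := hy
    exact ⟨H x y (by simpa) hy', H y x hy' (by simpa)⟩
  · rintro x y z - - - ⟨ψ₁, h₁, rfl⟩ ⟨ψ₂, h₂, rfl⟩
    exact ⟨_, h₂.comp h₁, rfl⟩

/-- Finitely many points of an interval can be moved to arbitrary positions in the same order,
keeping the endpoints fixed. -/
lemma exists_interpolation {m : ℕ} {a b : Fin (m + 1) → ℝ} (ha : StrictMono a) (hb : StrictMono b)
    (h0 : a 0 = b 0) (hl : a (Fin.last m) = b (Fin.last m)) :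
    ∃ ψ, IsCompactlySupportedDiffeo (a 0) (a (Fin.last m)) ψ ∧ ∀ i, ψ (a i) = b i := by
  suffices H : ∀ j : ℕ, ∃ ψ, IsCompactlySupportedDiffeo (a 0) (a (Fin.last m)) ψ ∧
      ∀ i : Fin (m + 1), (i : ℕ) ≤ j → ψ (a i) = b i by
    obtain ⟨ψ, hψ, H⟩ := H m
    exact ⟨ψ, hψ, fun i ↦ H i (Nat.lt_succ_iff.1 i.2)⟩
  intro j
  induction j with
  | zero =>
    refine ⟨_, refl _ _, fun i hi ↦ ?_⟩
    obtain rfl : i = 0 := Fin.ext (by simpa using hi)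
    exact h0
  | succ j ih =>
    obtain ⟨ψ, hψ, H⟩ := ih
    rcases lt_trichotomy (j + 1) m with hj | rfl | hj
    · let i₀ : Fin (m + 1) := ⟨j, by omega⟩
      let i₁ : Fin (m + 1) := ⟨j + 1, by omega⟩
      have h01 : i₀ < i₁ := Fin.mk_lt_mk.2 (Nat.lt_succ_self j)
      have h1l : i₁ < Fin.last m := Fin.mk_lt_mk.2 hj
      have hsrc : ψ (a i₁) ∈ Ioo (b i₀) (b (Fin.last m)) := by
        rw [← H i₀ le_rfl, ← hl, ← hψ.eq_of_ge le_rfl]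
        exact ⟨hψ.strictMono (ha h01), hψ.strictMono (ha h1l)⟩
      obtain ⟨φ, hφ, hφe⟩ := exists_map_eq hsrc (v := b i₁) ⟨hb h01, hb h1l⟩
      refine ⟨_, (hφ.mono ?_ hl.ge).comp hψ, fun i hi ↦ ?_⟩
      · rw [h0]; exact hb.monotone (Fin.zero_le _)
      · rcases Nat.le_succ_iff.1 hi with hi | hi
        · rw [Function.comp, H i hi]
          exact hφ.eq_of_le (hb.monotone (Fin.mk_le_mk.2 hi))
        · obtain rfl : i = i₁ := Fin.ext hi
          exact hφe
    · refine ⟨ψ, hψ, fun i hi ↦ ?_⟩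
      rcases Nat.le_succ_iff.1 hi with hi | hi
      · exact H i hi
      · obtain rfl : i = Fin.last _ := Fin.ext hi
        rw [hψ.eq_of_ge le_rfl, hl]
    · exact ⟨ψ, hψ, fun i hi ↦ H i (by omega)⟩

end IsCompactlySupportedDiffeo

section Graphs

variable {n : ℕ}

/-- If `h` does not depend on the first coordinate, its graph over the other ones is null. -/
lemma volume_setOf_apply_zero_eq {h : (Fin (n + 1) → ℝ) → ℝ} (hd : Differentiable ℝ h)
    (hi : ∀ x s, h (Function.update x 0 s) = h x) : volume {x | x 0 = h x} = 0 := by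
  have h0 : volume {x : Fin (n + 1) → ℝ | x 0 = 0} = 0 :=
    Measure.pi_hyperplane (fun _ ↦ (volume : Measure ℝ)) 0 0
  let T : (Fin (n + 1) → ℝ) → (Fin (n + 1) → ℝ) := fun x ↦ x + h x • Pi.single 0 1
  have hT : Differentiable ℝ T := differentiable_id.add (hd.smul_const _)
  refine measure_mono_null (fun x hx ↦ ?_)
    (addHaar_image_eq_zero_of_differentiableOn_of_addHaar_eq_zero volume hT.differentiableOn h0)
  refine ⟨Function.update x 0 0, by simp, ?_⟩
  funext j
  simp only [T, hi, Pi.add_apply, Pi.smul_apply, smul_eq_mul]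
  by_cases hj : j = 0
  · subst hj; simpa using hx.symm
  · simp [hj]

/-- The integral of `g` over the part of `P` lying below the graph of `h`. -/
noncomputable def integralBelow (g : (Fin (n + 1) → ℝ) → ℝ) (P : Set (Fin (n + 1) → ℝ))
    (h : (Fin (n + 1) → ℝ) → ℝ) : ℝ :=
  ∫ x in P ∩ {x | x 0 ≤ h x}, g x

variable {g : (Fin (n + 1) → ℝ) → ℝ} {P : Set (Fin (n + 1) → ℝ)}

lemma measurableSet_setOf_apply_zero_le {h : (Fin (n + 1) → ℝ) → ℝ} (hh : Measurable h) :
    MeasurableSet {x | x 0 ≤ h x} :=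
  measurableSet_le (measurable_pi_apply 0) hh

lemma tendsto_integralBelow {ι : Type*} {l : Filter ι} [l.IsCountablyGenerated]
    (hg : IntegrableOn g P) {h : ι → (Fin (n + 1) → ℝ) → ℝ}
    {H : (Fin (n + 1) → ℝ) → ℝ} (hh : ∀ i, Measurable (h i)) (hH : Measurable H)
    (hlim : ∀ᵐ x ∂volume.restrict P, Tendsto (fun i ↦ h i x) l (𝓝 (H x)))
    (hnull : volume {x | x 0 = H x} = 0) :
    Tendsto (fun i ↦ integralBelow g P (h i)) l (𝓝 (integralBelow g P H)) := by
  have key : ∀ h : (Fin (n + 1) → ℝ) → ℝ, Measurable h →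
      integralBelow g P h = ∫ x in P, {x | x 0 ≤ h x}.indicator g x := fun h hm ↦
    (setIntegral_indicator (measurableSet_setOf_apply_zero_le hm)).symm
  simp_rw [key _ (hh _), key _ hH]
  refine tendsto_integral_filter_of_dominated_convergence (fun x ↦ ‖g x‖)
    (Eventually.of_forall fun i ↦
      hg.aestronglyMeasurable.indicator (measurableSet_setOf_apply_zero_le (hh i)))
    (Eventually.of_forall fun i ↦ Eventually.of_forall fun x ↦ norm_indicator_le_norm_self _ _)
    hg.norm ?_
  have hne : ∀ᵐ x ∂volume.restrict P, x 0 ≠ H x :=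
    ae_restrict_of_ae (measure_eq_zero_iff_ae_notMem.1 hnull)
  filter_upwards [hlim, hne] with x hx hxne
  refine tendsto_const_nhds.congr' ?_
  rcases lt_or_gt_of_ne hxne with hlt | hlt
  · filter_upwards [hx.eventually (lt_mem_nhds hlt)] with i hi
    rw [indicator_of_mem (show x ∈ {x | x 0 ≤ H x} from hlt.le),
      indicator_of_mem (show x ∈ {x | x 0 ≤ h i x} from hi.le)]
  · filter_upwards [hx.eventually (gt_mem_nhds hlt)] with i hi
    rw [indicator_of_notMem (show x ∉ {x | x 0 ≤ H x} from not_le.2 hlt),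
      indicator_of_notMem (show x ∉ {x | x 0 ≤ h i x} from not_le.2 hi)]

lemma setIntegral_between (hP : MeasurableSet P) (hg : IntegrableOn g P)
    {A B : (Fin (n + 1) → ℝ) → ℝ} (hA : Measurable A) (hAB : ∀ x ∈ P, A x ≤ B x)
    (hnull : volume {x | x 0 = A x} = 0) :
    ∫ x in P ∩ {x | A x ≤ x 0 ∧ x 0 ≤ B x}, g x = integralBelow g P B - integralBelow g P A := by
  have hsub : P ∩ {x | x 0 ≤ A x} ⊆ P ∩ {x | x 0 ≤ B x} :=
    fun x hx ↦ ⟨hx.1, le_trans hx.2 (hAB x hx.1)⟩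
  rw [integralBelow, integralBelow,
    ← setIntegral_sdiff (hP.inter (measurableSet_setOf_apply_zero_le hA))
      (hg.mono_set inter_subset_left) hsub]
  refine setIntegral_congr_set ?_
  have hne : ∀ᵐ x, x 0 ≠ A x := measure_eq_zero_iff_ae_notMem.1 hnull
  filter_upwards [hne] with x hx
  refine propext ⟨fun ⟨h1, h2, h3⟩ ↦ ⟨⟨h1, h3⟩, fun h4 ↦ hx (le_antisymm h4.2 h2)⟩,
    fun ⟨⟨h1, h2⟩, h3⟩ ↦ ⟨h1, (not_le.1 fun h ↦ h3 ⟨h1, h⟩).le, h2⟩⟩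

end Graphs

section Slab

variable {n : ℕ}

/-- The box `[p, q] × [0, 1]ⁿ`. -/
def slab (n : ℕ) (p q : ℝ) : Set (Fin (n + 1) → ℝ) :=
  {x | x 0 ∈ Icc p q ∧ ∀ i, i ≠ 0 → x i ∈ Icc (0 : ℝ) 1}

lemma isClosed_slab (p q : ℝ) : IsClosed (slab n p q) := by
  have : slab n p q = (fun x ↦ x 0) ⁻¹' Icc p q ∩
      ⋂ (i : Fin (n + 1)) (_ : i ≠ 0), (fun x ↦ x i) ⁻¹' Icc (0 : ℝ) 1 := by
    ext x; simp [slab]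
  rw [this]
  exact (isClosed_Icc.preimage (continuous_apply _)).inter <|
    isClosed_iInter fun i ↦ isClosed_iInter fun _ ↦ isClosed_Icc.preimage (continuous_apply _)

lemma isOpen_openSlab (p q : ℝ) :
    IsOpen {x : Fin (n + 1) → ℝ | x 0 ∈ Ioo p q ∧ ∀ i, i ≠ 0 → x i ∈ Ioo (0 : ℝ) 1} := by
  have : {x : Fin (n + 1) → ℝ | x 0 ∈ Ioo p q ∧ ∀ i, i ≠ 0 → x i ∈ Ioo (0 : ℝ) 1} =
      (fun x ↦ x 0) ⁻¹' Ioo p q ∩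
      ⋂ (i : Fin (n + 1)) (_ : i ≠ 0), (fun x ↦ x i) ⁻¹' Ioo (0 : ℝ) 1 := by
    ext x; simp
  rw [this]
  refine (isOpen_Ioo.preimage (continuous_apply _)).inter <|
    isOpen_iInter_of_finite fun i ↦ isOpen_iInter_of_finite fun _ ↦
      isOpen_Ioo.preimage (continuous_apply _)

lemma openSlab_subset_slab (p q : ℝ) :
    {x : Fin (n + 1) → ℝ | x 0 ∈ Ioo p q ∧ ∀ i, i ≠ 0 → x i ∈ Ioo (0 : ℝ) 1} ⊆ slab n p q :=
  fun _ hx ↦ ⟨Ioo_subset_Icc_self hx.1, fun i hi ↦ Ioo_subset_Icc_self (hx.2 i hi)⟩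

lemma volume_slab_pos {p q : ℝ} (h : p < q) : 0 < volume (slab n p q) := by
  refine lt_of_lt_of_le ((isOpen_openSlab p q).measure_pos volume ?_)
    (measure_mono (openSlab_subset_slab p q))
  refine ⟨fun i ↦ if i = 0 then (p + q) / 2 else 1 / 2, ?_, fun i hi ↦ ?_⟩
  · simp only [if_true, mem_Ioo]; constructor <;> linarith
  · simp only [hi, if_false, mem_Ioo]; norm_num

variable {p q : ℝ} {g : (Fin (n + 1) → ℝ) → ℝ}

lemma slab_inter_between {t t' : ℝ} (ht : p ≤ t) (ht' : t' ≤ q) :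
    slab n p q ∩ {x | t ≤ x 0 ∧ x 0 ≤ t'} = slab n t t' := by
  ext x
  simp only [slab, mem_inter_iff, mem_ofPred_eq, mem_Icc]
  constructor
  · rintro ⟨⟨-, h⟩, h'⟩; exact ⟨h', h⟩
  · rintro ⟨h', h⟩; exact ⟨⟨⟨ht.trans h'.1, h'.2.trans ht'⟩, h⟩, h'⟩

lemma volume_setOf_apply_zero_eq_const (t : ℝ) :
    volume {x : Fin (n + 1) → ℝ | x 0 = t} = 0 :=
  Measure.pi_hyperplane (fun _ ↦ (volume : Measure ℝ)) 0 t

lemma setIntegral_slab (hg : IntegrableOn g (slab n p q)) {t t' : ℝ} (ht : p ≤ t) (htt : t ≤ t')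
    (ht' : t' ≤ q) : ∫ x in slab n t t', g x =
      integralBelow g (slab n p q) (fun _ ↦ t') - integralBelow g (slab n p q) (fun _ ↦ t) := by
  rw [← slab_inter_between ht ht']
  exact setIntegral_between (isClosed_slab p q).measurableSet hg (A := fun _ ↦ t)
    (B := fun _ ↦ t') measurable_const (fun _ _ ↦ htt) (volume_setOf_apply_zero_eq_const t)

lemma strictMonoOn_integralBelow (hg : IntegrableOn g (slab n p q))
    (hpos : ∀ᵐ x ∂volume.restrict (slab n p q), 0 < g x) :
    StrictMonoOn (fun t ↦ integralBelow g (slab n p q) (fun _ ↦ t)) (Icc p q) := by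
  intro t ht t' ht' htt
  have hsub : slab n t t' ⊆ slab n p q := by
    rw [← slab_inter_between ht.1 ht'.2]; exact inter_subset_left
  have hpos' : ∀ᵐ x ∂volume.restrict (slab n t t'), 0 < g x :=
    ae_restrict_of_ae_restrict_of_subset hsub hpos
  have h : 0 < ∫ x in slab n t t', g x := by
    rw [integral_pos_iff_support_of_nonneg_ae (hpos'.mono fun x hx ↦ hx.le) (hg.mono_set hsub)]
    have : volume.restrict (slab n t t') (Function.support g) =
        volume.restrict (slab n t t') univ :=
      measure_congr (hpos'.mono fun x hx ↦ propext ⟨fun _ ↦ trivial, fun _ ↦ hx.ne'⟩)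
    rw [this, Measure.restrict_apply_univ]
    exact volume_slab_pos htt
  rw [setIntegral_slab hg ht.1 htt.le ht'.2] at h
  exact sub_pos.1 h

lemma integralBelow_left : integralBelow g (slab n p q) (fun _ ↦ p) = 0 := by
  refine setIntegral_measure_zero _
    (measure_mono_null (fun x hx ↦ ?_) (volume_setOf_apply_zero_eq_const p))
  exact le_antisymm hx.2 hx.1.1.1

lemma integralBelow_right :
    integralBelow g (slab n p q) (fun _ ↦ q) = ∫ x in slab n p q, g x := by
  rw [integralBelow, inter_eq_left.2 fun x hx ↦ hx.1.2]

end Slab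

section Cutoff

variable {n : ℕ}

/-- A smooth cutoff on the line, supported in a compact subset of `(0, 1)` and equal to `1` on
larger and larger subsets as `m` grows. -/
noncomputable def unitCutoff (m : ℕ) (s : ℝ) : ℝ :=
  Real.smoothTransition ((m + 1) * s - 1) * Real.smoothTransition ((m + 1) * (1 - s) - 1)

/-- The product of the cutoffs `unitCutoff m` over all coordinates but the first one. -/
noncomputable def cubeCutoff (n m : ℕ) (x : Fin (n + 1) → ℝ) : ℝ :=
  ∏ j : Fin n, unitCutoff m (x j.succ)

lemma contDiff_cubeCutoff (m : ℕ) : ContDiff ℝ (⊤ : ℕ∞) (cubeCutoff n m) := by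
  refine contDiff_prod fun j _ ↦ ?_
  have hj : ContDiff ℝ (⊤ : ℕ∞) (fun x : Fin (n + 1) → ℝ ↦ x j.succ) := contDiff_apply _ _ _
  exact (Real.smoothTransition.contDiff.comp ((contDiff_const.mul hj).sub contDiff_const)).mul
    (Real.smoothTransition.contDiff.comp
      ((contDiff_const.mul (contDiff_const.sub hj)).sub contDiff_const))

lemma cubeCutoff_congr (m : ℕ) {x y : Fin (n + 1) → ℝ} (h : ∀ j ≠ 0, x j = y j) :
    cubeCutoff n m x = cubeCutoff n m y :=
  Finset.prod_congr rfl fun j _ ↦ by rw [h _ j.succ_ne_zero]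

lemma cubeCutoff_update (m : ℕ) (x : Fin (n + 1) → ℝ) (s : ℝ) :
    cubeCutoff n m (Function.update x 0 s) = cubeCutoff n m x :=
  cubeCutoff_congr m fun j hj ↦ by simp [hj]

lemma unitCutoff_nonneg (m : ℕ) (s : ℝ) : 0 ≤ unitCutoff m s :=
  mul_nonneg (Real.smoothTransition.nonneg _) (Real.smoothTransition.nonneg _)

lemma unitCutoff_le_one (m : ℕ) (s : ℝ) : unitCutoff m s ≤ 1 :=
  mul_le_one₀ (Real.smoothTransition.le_one _) (Real.smoothTransition.nonneg _)
    (Real.smoothTransition.le_one _)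

lemma cubeCutoff_mem_Icc (m : ℕ) (x : Fin (n + 1) → ℝ) : cubeCutoff n m x ∈ Icc (0 : ℝ) 1 :=
  ⟨Finset.prod_nonneg fun _ _ ↦ unitCutoff_nonneg _ _,
    Finset.prod_le_one (fun _ _ ↦ unitCutoff_nonneg _ _) fun _ _ ↦ unitCutoff_le_one _ _⟩

lemma eventually_unitCutoff_eq_one {s : ℝ} (hs : s ∈ Ioo (0 : ℝ) 1) :
    ∀ᶠ m in atTop, unitCutoff m s = 1 := by
  have key : ∀ r : ℝ, 0 < r → ∀ᶠ m : ℕ in atTop, (1 : ℝ) ≤ (m + 1) * r - 1 := fun r hr ↦ by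
    filter_upwards [tendsto_natCast_atTop_atTop.eventually_ge_atTop (2 / r)] with m hm
    rw [div_le_iff₀ hr] at hm
    linarith
  filter_upwards [key s hs.1, key (1 - s) (sub_pos.2 hs.2)] with m h1 h2
  rw [unitCutoff, Real.smoothTransition.one_of_one_le h1, Real.smoothTransition.one_of_one_le h2,
    one_mul]

lemma eventually_cubeCutoff_eq_one {x : Fin (n + 1) → ℝ}
    (hx : ∀ j, j ≠ 0 → x j ∈ Ioo (0 : ℝ) 1) : ∀ᶠ m in atTop, cubeCutoff n m x = 1 := by
  have : ∀ᶠ m in atTop, ∀ j : Fin n, unitCutoff m (x j.succ) = 1 :=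
    eventually_all.2 fun j ↦ eventually_unitCutoff_eq_one (hx _ j.succ_ne_zero)
  filter_upwards [this] with m hm
  exact Finset.prod_eq_one fun j _ ↦ hm j

lemma eventually_unitCutoff_eq_zero (m : ℕ) {s : ℝ} (hs : s ∉ Ioo (0 : ℝ) 1) :
    ∀ᶠ t in 𝓝 s, unitCutoff m t = 0 := by
  have hm : (0 : ℝ) < m + 1 := by positivity
  rcases le_or_gt s 0 with h | h
  · filter_upwards [gt_mem_nhds (h.trans_lt (one_div_pos.2 hm))] with t ht
    rw [lt_div_iff₀' hm] at ht
    rw [unitCutoff, Real.smoothTransition.zero_of_nonpos (by linarith), zero_mul]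
  · have h1 : 1 ≤ s := not_lt.1 fun h' ↦ hs ⟨h, h'⟩
    filter_upwards [lt_mem_nhds (show 1 - 1 / (m + 1 : ℝ) < s from
      (sub_lt_self _ (one_div_pos.2 hm)).trans_le h1)] with t ht
    rw [sub_lt_comm, lt_div_iff₀' hm] at ht
    rw [unitCutoff, Real.smoothTransition.zero_of_nonpos (x := _ * (1 - t) - 1) (by linarith),
      mul_zero]

lemma eventually_cubeCutoff_eq_zero (m : ℕ) {x : Fin (n + 1) → ℝ} {j : Fin (n + 1)} (hj : j ≠ 0)
    (hx : x j ∉ Ioo (0 : ℝ) 1) : ∀ᶠ y in 𝓝 x, cubeCutoff n m y = 0 := by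
  obtain ⟨i, rfl⟩ := Fin.exists_succ_eq.2 hj
  filter_upwards [(continuous_apply i.succ).continuousAt.eventually
    (eventually_unitCutoff_eq_zero m hx)] with y hy
  exact Finset.prod_eq_zero (Finset.mem_univ i) hy

end Cutoff

section Interfaces

variable {n : ℕ}

/-- The graph interpolating between the hyperplanes `x 0 = s` (near the lateral boundary of the
box) and `x 0 = t` (away from it). -/
noncomputable def interface (n m : ℕ) (s t : ℝ) (x : Fin (n + 1) → ℝ) : ℝ :=
  s + cubeCutoff n m x * (t - s)

lemma differentiable_interface (m : ℕ) (s t : ℝ) : Differentiable ℝ (interface n m s t) :=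
  (((contDiff_cubeCutoff m).differentiable (by simp)).mul_const _).const_add _

lemma measurable_interface (m : ℕ) (s t : ℝ) : Measurable (interface n m s t) :=
  (differentiable_interface m s t).continuous.measurable

lemma interface_self (m : ℕ) (s : ℝ) : interface n m s s = fun _ ↦ s := by
  funext x; simp [interface]

lemma volume_setOf_eq_interface (m : ℕ) (s t : ℝ) :
    volume {x : Fin (n + 1) → ℝ | x 0 = interface n m s t x} = 0 :=
  volume_setOf_apply_zero_eq (differentiable_interface m s t) fun x r ↦ by
    rw [interface, cubeCutoff_update, interface]

variable {p q : ℝ} {g : (Fin (n + 1) → ℝ) → ℝ}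

lemma continuous_integralBelow_interface (hg : IntegrableOn g (slab n p q)) (m : ℕ) (s : ℝ) :
    Continuous fun t ↦ integralBelow g (slab n p q) (interface n m s t) :=
  continuous_iff_continuousAt.2 fun t ↦
    tendsto_integralBelow hg (fun r ↦ measurable_interface m s r) (measurable_interface m s t)
      (Eventually.of_forall fun _ ↦
        (continuous_const.add (continuous_const.mul (continuous_id.sub continuous_const))).tendsto t)
      (volume_setOf_eq_interface m s t)

lemma continuous_integralBelow_const (hg : IntegrableOn g (slab n p q)) :
    Continuous fun t ↦ integralBelow g (slab n p q) (fun _ ↦ t) :=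
  continuous_iff_continuousAt.2 fun t ↦
    tendsto_integralBelow hg (fun _ ↦ measurable_const) measurable_const
      (Eventually.of_forall fun _ ↦ tendsto_id) (volume_setOf_apply_zero_eq_const t)

lemma tendsto_integralBelow_interface (hg : IntegrableOn g (slab n p q)) (s t : ℝ) :
    Tendsto (fun m ↦ integralBelow g (slab n p q) (interface n m s t)) atTop
      (𝓝 (integralBelow g (slab n p q) (fun _ ↦ t))) := by
  refine tendsto_integralBelow hg (fun m ↦ measurable_interface m s t) measurable_const ?_
    (volume_setOf_apply_zero_eq_const t)
  have hne : ∀ᵐ x : Fin (n + 1) → ℝ, ∀ j, x j ≠ 0 ∧ x j ≠ 1 := ae_all_iff.2 fun j ↦ by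
    have h : ∀ c : ℝ, ∀ᵐ x : Fin (n + 1) → ℝ, x j ≠ c := fun c ↦
      measure_eq_zero_iff_ae_notMem.1 (Measure.pi_hyperplane (fun _ ↦ (volume : Measure ℝ)) j c)
    exact (h 0).and (h 1)
  filter_upwards [ae_restrict_of_ae hne, ae_restrict_mem (isClosed_slab p q).measurableSet]
    with x hx hxP
  refine tendsto_const_nhds.congr' ?_
  filter_upwards [eventually_cubeCutoff_eq_one (x := x) fun j hj ↦
    ⟨(hxP.2 j hj).1.lt_of_ne (hx j).1.symm, (hxP.2 j hj).2.lt_of_ne (hx j).2⟩] with m hm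
  simp [interface, hm]

/-- For a fine enough cutoff, the interfaces starting at prescribed positions `a i` near the
lateral boundary can be bent so as to cut off prescribed masses. -/
lemma exists_integralBelow_interface_eq {K : ℕ} {a M : Fin (K + 1) → ℝ}
    (ha : a 0 ≤ a (Fin.last K))
    (hg : IntegrableOn g (slab n (a 0) (a (Fin.last K))))
    (hpos : ∀ᵐ x ∂volume.restrict (slab n (a 0) (a (Fin.last K))), 0 < g x)
    (hM : StrictMono M) (hM0 : M 0 = 0)
    (hMl : M (Fin.last K) = ∫ x in slab n (a 0) (a (Fin.last K)), g x) :
    ∃ (m : ℕ) (b : Fin (K + 1) → ℝ), StrictMono b ∧ a 0 = b 0 ∧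
      a (Fin.last K) = b (Fin.last K) ∧
      ∀ i, integralBelow g (slab n (a 0) (a (Fin.last K))) (interface n m (a i) (b i)) = M i := by
  set p := a 0 with hp
  set q := a (Fin.last K) with hq
  set G : ℝ → ℝ := fun t ↦ integralBelow g (slab n p q) (fun _ ↦ t)
  have hGmono : StrictMonoOn G (Icc p q) := strictMonoOn_integralBelow hg hpos
  have hGp : G p = M 0 := by rw [hM0]; exact integralBelow_left
  have hGq : G q = M (Fin.last K) := by rw [hMl]; exact integralBelow_right
  have hc : ∀ i, ∃ c ∈ Icc p q, G c = M i := fun i ↦ by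
    have := intermediate_value_Icc ha (continuous_integralBelow_const hg).continuousOn
    exact this ⟨hGp.trans_le (hM.monotone (Fin.zero_le i)),
      (hM.monotone (Fin.le_last i)).trans_eq hGq.symm⟩
  choose c hcI hcM using hc
  have hcmono : StrictMono c := fun i j hij ↦
    (hGmono.lt_iff_lt (hcI i) (hcI j)).1 (by rw [hcM, hcM]; exact hM hij)
  have hc0 : c 0 = p := hGmono.injOn (hcI 0) (left_mem_Icc.2 ha) ((hcM 0).trans hGp.symm)
  have hcl : c (Fin.last K) = q :=
    hGmono.injOn (hcI _) (right_mem_Icc.2 ha) ((hcM _).trans hGq.symm)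
  obtain ⟨r, hr, hr0⟩ : ∃ r : ℝ, (∀ i j, i < j → c i + r < c j - r) ∧ 0 < r := by
    have h1 : ∀ᶠ r : ℝ in 𝓝[>] 0, ∀ i j, i < j → c i + r < c j - r := by
      refine eventually_all.2 fun i ↦ eventually_all.2 fun j ↦
        eventually_imp_distrib_left.2 fun hij ↦ mem_nhdsWithin_of_mem_nhds ?_
      refine (ContinuousAt.eventually_lt (f := fun r : ℝ ↦ c i + r) (g := fun r : ℝ ↦ c j - r)
        (by fun_prop) (by fun_prop) ?_)
      simpa using hcmono hij
    exact (h1.and self_mem_nhdsWithin).exists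
  have hm : ∀ᶠ m in atTop, ∀ i, i ≠ 0 → i ≠ Fin.last K →
      integralBelow g (slab n p q) (interface n m (a i) (c i - r)) < M i ∧
      M i < integralBelow g (slab n p q) (interface n m (a i) (c i + r)) := by
    refine eventually_all.2 fun i ↦ eventually_imp_distrib_left.2 fun hi0 ↦
      eventually_imp_distrib_left.2 fun hil ↦ ?_
    have h0 := hr 0 i (Fin.pos_of_ne_zero hi0)
    have hl := hr i _ (Fin.lt_last_iff_ne_last.2 hil)
    rw [hc0] at h0
    rw [hcl] at hl
    have hlo : G (c i - r) < M i := by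
      rw [← hcM i]
      exact hGmono ⟨by linarith, by linarith [(hcI i).2]⟩ (hcI i) (by linarith)
    have hhi : M i < G (c i + r) := by
      rw [← hcM i]
      exact hGmono (hcI i) ⟨by linarith [(hcI i).1], by linarith⟩ (by linarith)
    exact ((tendsto_integralBelow_interface hg (a i) (c i - r)).eventually (gt_mem_nhds hlo)).and
      ((tendsto_integralBelow_interface hg (a i) (c i + r)).eventually (lt_mem_nhds hhi))
  obtain ⟨m, hm⟩ := hm.exists
  have hb : ∀ i, ∃ t ∈ Icc (c i - r) (c i + r), (i = 0 → t = p) ∧ (i = Fin.last K → t = q) ∧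
      integralBelow g (slab n p q) (interface n m (a i) t) = M i := fun i ↦ by
    have hci : c i ∈ Icc (c i - r) (c i + r) := ⟨by linarith, by linarith⟩
    by_cases hi0 : i = 0
    · subst hi0
      refine ⟨c 0, hci, fun _ ↦ hc0, fun h ↦ by rw [h, hcl], ?_⟩
      rw [hc0, hp, interface_self]
      exact hGp
    by_cases hil : i = Fin.last K
    · subst hil
      refine ⟨c _, hci, fun h ↦ absurd h hi0, fun _ ↦ hcl, ?_⟩
      rw [hcl, hq, interface_self]
      exact hGq
    obtain ⟨t, ht, hte⟩ := intermediate_value_Icc (by linarith : c i - r ≤ c i + r)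
      (continuous_integralBelow_interface hg m (a i)).continuousOn
      ⟨(hm i hi0 hil).1.le, (hm i hi0 hil).2.le⟩
    exact ⟨t, ht, fun h ↦ absurd h hi0, fun h ↦ absurd h hil, hte⟩
  choose b hbI hb0 hbl hbM using hb
  exact ⟨m, b, fun i j hij ↦ by linarith [hr i j hij, (hbI i).2, (hbI j).1], (hb0 0 rfl).symm,
    (hbl _ rfl).symm, hbM⟩

end Interfaces

section Shear

variable {n m : ℕ} {p q : ℝ} {ψ : ℝ → ℝ}

/-- The map applying `ψ` to the first coordinate, damped to the identity near the lateral boundary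
of the box. -/
noncomputable def shear (n m : ℕ) (ψ : ℝ → ℝ) (x : Fin (n + 1) → ℝ) : Fin (n + 1) → ℝ :=
  x + (cubeCutoff n m x * (ψ (x 0) - x 0)) • Pi.single 0 1

lemma shear_apply_zero (x : Fin (n + 1) → ℝ) :
    shear n m ψ x 0 = interface n m (x 0) (ψ (x 0)) x := by
  simp [shear, interface]

lemma shear_apply_of_ne (x : Fin (n + 1) → ℝ) {j : Fin (n + 1)} (hj : j ≠ 0) :
    shear n m ψ x j = x j := by
  simp [shear, hj]

lemma cubeCutoff_shear (x : Fin (n + 1) → ℝ) :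
    cubeCutoff n m (shear n m ψ x) = cubeCutoff n m x :=
  cubeCutoff_congr m fun _ hj ↦ shear_apply_of_ne x hj

lemma interface_shear (s t : ℝ) (x : Fin (n + 1) → ℝ) :
    interface n m s t (shear n m ψ x) = interface n m s t x := by
  rw [interface, cubeCutoff_shear, interface]

lemma interface_strictMono {s s' t t' : ℝ} (hs : s < s') (ht : t < t') (x : Fin (n + 1) → ℝ) :
    interface n m s t x < interface n m s' t' x := by
  obtain ⟨h0, h1⟩ := cubeCutoff_mem_Icc m x
  simp only [interface]
  rcases h0.eq_or_lt with h | h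
  · simpa [← h] using hs
  · nlinarith [mul_pos h (sub_pos.2 ht), mul_nonneg (sub_nonneg.2 h1) (sub_pos.2 hs).le]

lemma interface_strictMono_right (h : StrictMono ψ) (x : Fin (n + 1) → ℝ) :
    StrictMono fun s ↦ interface n m s (ψ s) x := fun _ _ hs ↦
  interface_strictMono hs (h hs) x

lemma injective_shear (h : StrictMono ψ) : Function.Injective (shear n m ψ) := by
  intro x y hxy
  have hne : ∀ j, j ≠ 0 → x j = y j := fun j hj ↦ by
    rw [← shear_apply_of_ne (m := m) (ψ := ψ) x hj, hxy, shear_apply_of_ne y hj]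
  have h0 : x 0 = y 0 := by
    refine (interface_strictMono_right (m := m) h x).injective ?_
    have := congrFun hxy 0
    rw [shear_apply_zero, shear_apply_zero] at this
    simpa only [interface, cubeCutoff_congr m hne] using this
  funext j
  by_cases hj : j = 0
  · rw [hj, h0]
  · exact hne j hj

lemma IsCompactlySupportedDiffeo.contDiff_shear (h : IsCompactlySupportedDiffeo p q ψ) :
    ContDiff ℝ (⊤ : ℕ∞) (shear n m ψ) := by
  have h0 : ContDiff ℝ (⊤ : ℕ∞) (fun x : Fin (n + 1) → ℝ ↦ x 0) := contDiff_apply _ _ _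
  exact contDiff_id.add
    (((contDiff_cubeCutoff m).mul ((h.contDiff.comp h0).sub h0)).smul contDiff_const)

/-- A map of the form `x ↦ x + c x • v` has invertible derivative as soon as the derivative of `c`
along `v` differs from `-1`. -/
lemma isUnit_fderiv_add_smul {E : Type*} [NormedAddCommGroup E] [NormedSpace ℝ E]
    [FiniteDimensional ℝ E] {c : E → ℝ} {x v : E} (hc : DifferentiableAt ℝ c x)
    (hv : 1 + fderiv ℝ c x v ≠ 0) : IsUnit (fderiv ℝ (fun y ↦ y + c y • v) x) := by
  have : CompleteSpace E := FiniteDimensional.complete ℝ E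
  have hd : fderiv ℝ (fun y ↦ y + c y • v) x =
      ContinuousLinearMap.id ℝ E + (fderiv ℝ c x).smulRight v :=
    ((hasFDerivAt_id x).add (hc.hasFDerivAt.smul_const v)).fderiv
  rw [hd, ContinuousLinearMap.isUnit_iff_bijective]
  set L := ContinuousLinearMap.id ℝ E + (fderiv ℝ c x).smulRight v with hL
  have hinj : Function.Injective L := by
    refine (injective_iff_map_eq_zero L).2 fun w hw ↦ ?_
    have hw' : w + fderiv ℝ c x w • v = 0 := by simpa [hL] using hw
    have h1 : fderiv ℝ c x w * (1 + fderiv ℝ c x v) = 0 := by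
      have := congrArg (fderiv ℝ c x) hw'
      simp only [map_add, map_smul, map_zero, smul_eq_mul] at this
      linarith
    rw [(mul_eq_zero.1 h1).resolve_right hv] at hw'
    simpa using hw'
  exact ⟨hinj, (LinearMap.injective_iff_surjective (f := (L : E →ₗ[ℝ] E))).1 hinj⟩

lemma IsCompactlySupportedDiffeo.isUnit_fderiv_shear (h : IsCompactlySupportedDiffeo p q ψ)
    (x : Fin (n + 1) → ℝ) : IsUnit (fderiv ℝ (shear n m ψ) x) := by
  have h0 : ContDiff ℝ (⊤ : ℕ∞) (fun x : Fin (n + 1) → ℝ ↦ x 0) := contDiff_apply _ _ _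
  have hc : DifferentiableAt ℝ (fun y ↦ cubeCutoff n m y * (ψ (y 0) - y 0)) x :=
    ((contDiff_cubeCutoff m).mul ((h.contDiff.comp h0).sub h0)).differentiable (by simp) x
  refine isUnit_fderiv_add_smul hc ?_
  have hline : HasDerivAt (fun s : ℝ ↦ cubeCutoff n m x * (ψ (x 0 + s) - (x 0 + s)))
      (fderiv ℝ (fun y ↦ cubeCutoff n m y * (ψ (y 0) - y 0)) x (Pi.single 0 1)) 0 := by
    have hl := hc.hasFDerivAt.hasLineDerivAt (Pi.single 0 1)
    rw [HasLineDerivAt] at hl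
    refine hl.congr_of_eventuallyEq (Eventually.of_forall fun s ↦ ?_)
    have : cubeCutoff n m (x + s • Pi.single 0 1) = cubeCutoff n m x :=
      cubeCutoff_congr m fun j hj ↦ by simp [hj]
    simp [this]
  have hline' : HasDerivAt (fun s : ℝ ↦ cubeCutoff n m x * (ψ (x 0 + s) - (x 0 + s)))
      (cubeCutoff n m x * (deriv ψ (x 0) - 1)) 0 := by
    have h1 : HasDerivAt (fun s : ℝ ↦ x 0 + s) 1 0 := (hasDerivAt_id 0).const_add _
    have h2 : HasDerivAt ψ (deriv ψ (x 0)) (x 0 + 0) := by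
      rw [add_zero]; exact (h.differentiable _).hasDerivAt
    have h3 := h2.comp (0 : ℝ) h1
    simpa using (h3.sub h1).const_mul (cubeCutoff n m x)
  rw [hline.unique hline']
  obtain ⟨hχ0, hχ1⟩ := cubeCutoff_mem_Icc m x
  have hd := h.deriv_pos (x 0)
  rcases hχ0.eq_or_lt with h | h
  · simp [← h]
  · nlinarith [mul_pos h hd]

lemma shear_preimage_slab (h : IsCompactlySupportedDiffeo p q ψ) (x : Fin (n + 1) → ℝ) :
    shear n m ψ x ∈ slab n p q ↔ x ∈ slab n p q := by
  have hmono := interface_strictMono_right (m := m) h.strictMono x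
  have hp : interface n m p (ψ p) x = p := by rw [h.eq_of_le le_rfl, interface_self]
  have hq : interface n m q (ψ q) x = q := by rw [h.eq_of_ge le_rfl, interface_self]
  have h1 : p ≤ shear n m ψ x 0 ↔ p ≤ x 0 := by
    rw [shear_apply_zero]; nth_rewrite 1 [← hp]; exact hmono.le_iff_le
  have h2 : shear n m ψ x 0 ≤ q ↔ x 0 ≤ q := by
    rw [shear_apply_zero]; nth_rewrite 1 [← hq]; exact hmono.le_iff_le
  simp only [slab, mem_ofPred_eq, mem_Icc, h1, h2]
  refine and_congr_right fun _ ↦ forall_congr' fun j ↦ forall_congr' fun hj ↦ ?_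
  rw [shear_apply_of_ne x hj]

lemma bijOn_shear (h : IsCompactlySupportedDiffeo p q ψ) :
    BijOn (shear n m ψ) (slab n p q) (slab n p q) := by
  refine ⟨fun x hx ↦ (shear_preimage_slab h x).2 hx, (injective_shear h.strictMono).injOn,
    fun y hy ↦ ?_⟩
  have hcont : ContinuousOn (fun s ↦ interface n m s (ψ s) y) (Icc p q) :=
    (continuous_id.add (continuous_const.mul
      (h.contDiff.continuous.sub continuous_id))).continuousOn
  have hp : interface n m p (ψ p) y = p := by rw [h.eq_of_le le_rfl, interface_self]
  have hq : interface n m q (ψ q) y = q := by rw [h.eq_of_ge le_rfl, interface_self]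
  obtain ⟨s, -, hs⟩ := intermediate_value_Icc (hy.1.1.trans hy.1.2) hcont
    ⟨hp.trans_le hy.1.1, hy.1.2.trans_eq hq.symm⟩
  have hsy : shear n m ψ (Function.update y 0 s) = y := by
    funext j
    by_cases hj : j = 0
    · subst hj
      rw [shear_apply_zero, Function.update_self, interface, cubeCutoff_update]
      exact hs
    · rw [shear_apply_of_ne _ hj, Function.update_of_ne hj]
  exact ⟨_, (shear_preimage_slab h _).1 (hsy ▸ hy), hsy⟩

lemma image_shear_slab (h : IsCompactlySupportedDiffeo p q ψ) {t t' : ℝ} (ht : p ≤ t)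
    (ht' : t' ≤ q) : shear n m ψ '' slab n t t' = slab n p q ∩
      {x | interface n m t (ψ t) x ≤ x 0 ∧ x 0 ≤ interface n m t' (ψ t') x} := by
  have key : ∀ x, (interface n m t (ψ t) (shear n m ψ x) ≤ shear n m ψ x 0 ∧
      shear n m ψ x 0 ≤ interface n m t' (ψ t') (shear n m ψ x)) ↔ t ≤ x 0 ∧ x 0 ≤ t' := by
    intro x
    have hmono := interface_strictMono_right (m := m) h.strictMono x
    rw [interface_shear, interface_shear, shear_apply_zero]
    exact and_congr hmono.le_iff_le hmono.le_iff_le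
  rw [← slab_inter_between ht ht']
  ext y
  constructor
  · rintro ⟨x, ⟨hx, hxt⟩, rfl⟩
    exact ⟨(shear_preimage_slab h x).2 hx, (key x).2 hxt⟩
  · rintro ⟨hy, hyt⟩
    obtain ⟨x, hx, rfl⟩ := (bijOn_shear (m := m) h).surjOn hy
    exact ⟨x, ⟨hx, (key x).1 hyt⟩, rfl⟩

lemma eventually_shear_eq (h : IsCompactlySupportedDiffeo p q ψ) {x : Fin (n + 1) → ℝ}
    (hx : x ∈ frontier (slab n p q)) : ∀ᶠ y in 𝓝 x, shear n m ψ y = y := by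
  have hx0 : ¬ (x 0 ∈ Ioo p q ∧ ∀ i, i ≠ 0 → x i ∈ Ioo (0 : ℝ) 1) := fun H ↦
    hx.2 (interior_maximal (openSlab_subset_slab p q) (isOpen_openSlab p q) H)
  by_cases H : x 0 ∈ Ioo p q
  · have : ∃ i, i ≠ 0 ∧ x i ∉ Ioo (0 : ℝ) 1 := by
      by_contra! H'
      exact hx0 ⟨H, H'⟩
    obtain ⟨i, hi, hxi⟩ := this
    filter_upwards [eventually_cubeCutoff_eq_zero m hi hxi] with y hy
    simp [shear, hy]
  · have hψ : ∀ᶠ s in 𝓝 (x 0), ψ s = s := by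
      rcases le_or_gt (x 0) p with hp | hp
      · obtain ⟨p', hp', h'⟩ := h.exists_eq_left
        filter_upwards [gt_mem_nhds (hp.trans_lt hp')] with s hs using h' s hs.le
      · obtain ⟨q', hq', h'⟩ := h.exists_eq_right
        have hq : q ≤ x 0 := not_lt.1 fun hq ↦ H ⟨hp, hq⟩
        filter_upwards [lt_mem_nhds (hq'.trans_le hq)] with s hs using h' s hs.le
    filter_upwards [(continuous_apply 0).continuousAt.eventually hψ] with y hy
    simp [shear, hy]

end Shear

/-- Equipartition of measures along a sliced box: if `P = [0,a] × [0,1]^{n−1}` is split into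
adjacent boxes `P_i` along the first coordinate, and `f, g > 0` a.e. are integrable with
`∫_P f = ∫_P g`, then there is a `C^∞` diffeomorphism `Φ : P → P`, identity near `∂P`, with
`∫_{P_i} f = ∫_{Φ(P_i)} g` for every `i`. -/
theorem stmt14 {n k : ℕ}
    (a : Fin (k + 3) → ℝ) (ha : StrictMono a) (h0 : a 0 = 0)
    (P : Set (Fin (n + 2) → ℝ))
    (hP : P = {x | x 0 ∈ Set.Icc (a 0) (a (Fin.last (k + 2))) ∧
      ∀ i, i ≠ 0 → x i ∈ Set.Icc (0 : ℝ) 1})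
    (Pb : Fin (k + 2) → Set (Fin (n + 2) → ℝ))
    (hPb : ∀ i, Pb i = {x | x 0 ∈ Set.Icc (a i.castSucc) (a i.succ) ∧
      ∀ j, j ≠ 0 → x j ∈ Set.Icc (0 : ℝ) 1})
    (f g : (Fin (n + 2) → ℝ) → ℝ)
    (hfi : IntegrableOn f P) (hgi : IntegrableOn g P)
    (hfpos : ∀ᵐ x ∂volume.restrict P, 0 < f x)
    (hgpos : ∀ᵐ x ∂volume.restrict P, 0 < g x)
    (heq : ∫ x in P, f x = ∫ x in P, g x) :
    ∃ Φ : (Fin (n + 2) → ℝ) → (Fin (n + 2) → ℝ),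
      (∃ U, IsOpen U ∧ P ⊆ U ∧ ContDiffOn ℝ (⊤ : ℕ∞) Φ U ∧ Set.InjOn Φ U ∧
        ∀ x ∈ U, IsUnit (fderiv ℝ Φ x)) ∧
      Set.BijOn Φ P P ∧
      (∃ V, IsOpen V ∧ frontier P ⊆ V ∧ Set.EqOn Φ id V) ∧
      ∀ i, ∫ x in Pb i, f x = ∫ x in Φ '' Pb i, g x := by
  obtain rfl : Pb = fun i ↦ slab (n + 1) (a i.castSucc) (a i.succ) := funext hPb
  change P = slab (n + 1) (a 0) (a (Fin.last (k + 2))) at hP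
  subst hP
  have ha0 : ∀ i, a 0 ≤ a i := fun i ↦ ha.monotone (Fin.zero_le i)
  have hal : ∀ i, a i ≤ a (Fin.last (k + 2)) := fun i ↦ ha.monotone (Fin.le_last i)
  set P := slab (n + 1) (a 0) (a (Fin.last (k + 2)))
  obtain ⟨m, b, hb, hb0, hbl, hbM⟩ := exists_integralBelow_interface_eq
    (M := fun i ↦ integralBelow f P fun _ ↦ a i) (ha0 _) hgi hgpos
    (fun i j hij ↦ strictMonoOn_integralBelow hfi hfpos ⟨ha0 i, hal i⟩ ⟨ha0 j, hal j⟩ (ha hij))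
    integralBelow_left (integralBelow_right.trans heq)
  obtain ⟨ψ, hψ, hψab⟩ := IsCompactlySupportedDiffeo.exists_interpolation ha hb hb0 hbl
  refine ⟨shear (n + 1) m ψ, ⟨Set.univ, isOpen_univ, Set.subset_univ _,
    hψ.contDiff_shear.contDiffOn, (injective_shear hψ.strictMono).injOn,
    fun x _ ↦ hψ.isUnit_fderiv_shear x⟩, bijOn_shear hψ,
    ⟨interior {x | shear (n + 1) m ψ x = x}, isOpen_interior,
      fun x hx ↦ mem_interior_iff_mem_nhds.2 (eventually_shear_eq hψ hx),
      fun x hx ↦ (interior_subset hx : x ∈ {x | shear (n + 1) m ψ x = x})⟩, fun i ↦ ?_⟩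
  have hi : i.castSucc < i.succ := Fin.castSucc_lt_succ
  rw [setIntegral_slab hfi (ha0 _) (ha hi).le (hal _), image_shear_slab hψ (ha0 _) (hal _),
    hψab, hψab, setIntegral_between (isClosed_slab _ _).measurableSet hgi
      (measurable_interface m _ _) (fun x _ ↦ (interface_strictMono (ha hi) (hb hi) x).le)
      (volume_setOf_eq_interface m _ _), hbM, hbM]
end

section
/- Let U, V ⊂ ℝⁿ be open, f : U → ℝⁿ approximately differentiable a.e. with det D_a f(x) ≠ 0 a.e., f(U) ⊂ V, and g : V → ℝ^m approximately differentiable a.e. Then g ∘ f : U → ℝ^m is approximately differentiable a.e. and D_a(g ∘ f)(x) = D_a g(f(x)) · D_a f(x) for almost all x ∈ U. -/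
open MeasureTheory Filter Metric

/-- `x` is a Lebesgue density point of `E`. -/
def DensityPt {n : ℕ} (E : Set (EuclideanSpace ℝ (Fin n)))
    (x : EuclideanSpace ℝ (Fin n)) : Prop :=
  Tendsto (fun r => volume (E ∩ closedBall x r) / volume (closedBall x r))
    (nhdsWithin 0 (Set.Ioi 0)) (nhds 1)

/-- `f` is approximately differentiable at `x` with approximate derivative `L`. -/
def ApproxDiffAt {n : ℕ} {F : Type*} [NormedAddCommGroup F] [NormedSpace ℝ F]
    (f : EuclideanSpace ℝ (Fin n) → F) (L : EuclideanSpace ℝ (Fin n) →L[ℝ] F)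
    (x : EuclideanSpace ℝ (Fin n)) : Prop :=
  ∃ E : Set (EuclideanSpace ℝ (Fin n)), MeasurableSet E ∧ DensityPt E x ∧
    Tendsto (fun y => ‖f y - f x - L (y - x)‖ / ‖y - x‖)
      (nhdsWithin x (E \ {x})) (nhds 0)

open scoped ENNReal NNReal Topology

/-- `S` has Lebesgue outer density zero at `x`. -/
def ThinAt {n : ℕ} (S : Set (EuclideanSpace ℝ (Fin n))) (x : EuclideanSpace ℝ (Fin n)) : Prop :=
  ∀ η : ℝ≥0∞, 0 < η →
    ∀ᶠ r in 𝓝[>] (0 : ℝ), volume (S ∩ closedBall x r) ≤ η * volume (closedBall x r)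

section Thin

variable {n : ℕ} {S T : Set (EuclideanSpace ℝ (Fin n))} {x : EuclideanSpace ℝ (Fin n)}

theorem volume_closedBall_pos_of_pos {r : ℝ} (hr : 0 < r) : 0 < volume (closedBall x r) :=
  measure_closedBall_pos volume x hr

theorem ThinAt.mono_local (hT : ThinAt T x) {ρ : ℝ} (hρ : 0 < ρ)
    (h : S ∩ ball x ρ ⊆ T) : ThinAt S x := by
  intro η hη
  filter_upwards [hT η hη, Ioo_mem_nhdsGT hρ] with r hr hrρ
  refine (measure_mono ?_).trans hr
  rintro y ⟨hyS, hy⟩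
  exact ⟨h ⟨hyS, closedBall_subset_ball hrρ.2 hy⟩, hy⟩

theorem ThinAt.mono (hT : ThinAt T x) (h : S ⊆ T) : ThinAt S x :=
  hT.mono_local one_pos (Set.inter_subset_left.trans h)

theorem ThinAt.union (hS : ThinAt S x) (hT : ThinAt T x) : ThinAt (S ∪ T) x := by
  intro η hη
  have h2 : 0 < η / 2 := ENNReal.half_pos hη.ne'
  filter_upwards [hS _ h2, hT _ h2] with r h₁ h₂
  rw [Set.union_inter_distrib_right]
  calc _ ≤ _ := measure_union_le _ _
    _ ≤ η / 2 * volume (closedBall x r) + η / 2 * volume (closedBall x r) := add_le_add h₁ h₂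
    _ = _ := by rw [← add_mul, ENNReal.add_halves]

theorem thinAt_of_volume_eq_zero (h : volume S = 0) : ThinAt S x := fun η _ =>
  .of_forall fun _ => by simp [measure_mono_null Set.inter_subset_left h]

theorem tendsto_div_of_thinAt (hS : ThinAt S x) :
    Tendsto (fun r => volume (S ∩ closedBall x r) / volume (closedBall x r)) (𝓝[>] 0) (𝓝 0) := by
  rw [ENNReal.tendsto_nhds_zero]
  intro η hη
  filter_upwards [hS η hη] with r hr
  exact ENNReal.div_le_of_le_mul hr

theorem inter_div_add_compl_inter_div (hS : MeasurableSet S) {r : ℝ} (hr : 0 < r) :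
    volume (S ∩ closedBall x r) / volume (closedBall x r) +
      volume (Sᶜ ∩ closedBall x r) / volume (closedBall x r) = 1 := by
  rw [← ENNReal.add_div, Set.inter_comm S, Set.inter_comm Sᶜ, ← Set.sdiff_eq,
    measure_inter_add_sdiff _ hS]
  exact ENNReal.div_self (volume_closedBall_pos_of_pos hr).ne' measure_closedBall_lt_top.ne

theorem DensityPt.thinAt_compl (hS : MeasurableSet S) (h : DensityPt S x) : ThinAt Sᶜ x := by
  have h0 : Tendsto (fun r => volume (Sᶜ ∩ closedBall x r) / volume (closedBall x r))
      (𝓝[>] 0) (𝓝 0) := by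
    have := ENNReal.Tendsto.sub (tendsto_const_nhds (x := (1 : ℝ≥0∞))) h (.inl ENNReal.one_ne_top)
    rw [tsub_self] at this
    refine this.congr' ?_
    filter_upwards [self_mem_nhdsWithin] with r hr
    rw [← inter_div_add_compl_inter_div (x := x) hS hr]
    refine ENNReal.add_sub_cancel_left (ne_top_of_le_ne_top ENNReal.one_ne_top ?_)
    rw [← inter_div_add_compl_inter_div (x := x) hS hr]
    exact le_self_add
  intro η hη
  filter_upwards [(ENNReal.tendsto_nhds_zero.1 h0) η hη, self_mem_nhdsWithin] with r hr hr0
  exact (ENNReal.div_le_iff (volume_closedBall_pos_of_pos hr0).ne'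
    measure_closedBall_lt_top.ne).1 hr

theorem ThinAt.toMeasurable_set (h : ThinAt S x) : ThinAt (toMeasurable volume S) x := by
  intro η hη
  filter_upwards [h η hη] with r hr
  rwa [Measure.measure_toMeasurable_inter_of_sFinite measurableSet_closedBall]

theorem not_thinAt_univ : ¬ ThinAt Set.univ x := by
  intro h
  obtain ⟨r, hr, hr0⟩ := ((h (1 / 2) (by simp)).and self_mem_nhdsWithin).exists
  rw [Set.univ_inter] at hr
  refine hr.not_gt ?_
  calc _ < 1 * volume (closedBall x r) := by
        gcongr
        · exact (volume_closedBall_pos_of_pos hr0).ne'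
        · exact measure_closedBall_lt_top.ne
        · simp
    _ = _ := one_mul _

theorem ThinAt.exists_measurable_densityPt (h : ThinAt S x) :
    ∃ E, MeasurableSet E ∧ DensityPt E x ∧ E ⊆ Sᶜ := by
  refine ⟨(toMeasurable volume S)ᶜ, (measurableSet_toMeasurable _ _).compl, ?_,
    Set.compl_subset_compl.2 (subset_toMeasurable _ _)⟩
  have := ENNReal.Tendsto.sub (tendsto_const_nhds (x := (1 : ℝ≥0∞))) (tendsto_div_of_thinAt h.toMeasurable_set)
    (.inl ENNReal.one_ne_top)
  rw [tsub_zero] at this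
  refine this.congr' ?_
  filter_upwards [self_mem_nhdsWithin] with r hr
  have hadd := inter_div_add_compl_inter_div (x := x) (measurableSet_toMeasurable volume S) hr
  rw [← hadd]
  refine ENNReal.add_sub_cancel_left (ne_top_of_le_ne_top ENNReal.one_ne_top ?_)
  rw [← hadd]
  exact le_self_add

theorem IsOpen.thinAt_compl (hS : IsOpen S) (hx : x ∈ S) : ThinAt Sᶜ x := by
  obtain ⟨ρ, hρ, h⟩ := Metric.isOpen_iff.1 hS x hx
  exact (thinAt_of_volume_eq_zero (S := ∅) measure_empty).mono_local hρ
    fun y hy => hy.1 (h hy.2)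

theorem ae_thinAt_compl_toMeasurable (A : Set (EuclideanSpace ℝ (Fin n))) :
    ∀ᵐ x ∂volume, x ∈ toMeasurable volume A → ThinAt (toMeasurable volume A)ᶜ x := by
  have hm := measurableSet_toMeasurable volume A
  rw [← ae_restrict_iff' hm]
  filter_upwards [Besicovitch.ae_tendsto_measure_inter_div volume (toMeasurable volume A)]
    with x hx using DensityPt.thinAt_compl hm hx

theorem volume_closedBall_mul {y : EuclideanSpace ℝ (Fin n)} {a r : ℝ} (ha : 0 ≤ a) (hr : 0 ≤ r) :
    volume (closedBall y (a * r)) = ENNReal.ofReal (a ^ n) * volume (closedBall x r) := by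
  rw [Measure.addHaar_closedBall _ _ (mul_nonneg ha hr), Measure.addHaar_closedBall _ _ hr,
    finrank_euclideanSpace_fin, ← mul_assoc, ← ENNReal.ofReal_mul (by positivity), mul_pow]

theorem ApproxDiffAt.thinAt {F : Type*} [NormedAddCommGroup F] [NormedSpace ℝ F]
    {f : EuclideanSpace ℝ (Fin n) → F} {L : EuclideanSpace ℝ (Fin n) →L[ℝ] F}
    (h : ApproxDiffAt f L x) {ε : ℝ} (hε : 0 < ε) :
    ThinAt {y | ε * ‖y - x‖ < ‖f y - f x - L (y - x)‖} x := by
  obtain ⟨E, hE, hd, ht⟩ := h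
  have := ht.eventually_lt_const hε
  rw [eventually_nhdsWithin_iff, Metric.eventually_nhds_iff_ball] at this
  obtain ⟨ρ, hρ, h⟩ := this
  refine (hd.thinAt_compl hE).mono_local hρ ?_
  rintro y ⟨hy, hyρ⟩ hyE
  have hyx : y ≠ x := by
    rintro rfl
    simp at hy
  have := h y hyρ ⟨hyE, hyx⟩
  rw [div_lt_iff₀ (norm_pos_iff.2 (sub_ne_zero.2 hyx))] at this
  exact lt_asymm hy this

end Thin

theorem exists_volume_le_mul_volume_image (n : ℕ) (K : ℝ≥0) :
    ∃ C : ℝ≥0∞, C ≠ ∞ ∧ ∀ (f : EuclideanSpace ℝ (Fin n) → EuclideanSpace ℝ (Fin n))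
      (S : Set (EuclideanSpace ℝ (Fin n))),
      (∀ y ∈ S, ∀ z ∈ S, dist y z ≤ K * dist (f y) (f z)) →
      volume S ≤ C * volume (f '' S) := by
  refine ⟨(K : ℝ≥0∞) ^ (n : ℝ), ENNReal.rpow_ne_top_of_nonneg (by positivity) (by simp), ?_⟩
  intro f S h
  have hinj : Set.InjOn f S := by
    intro y hy z hz hyz
    have := h y hy z hz
    rw [hyz, dist_self, mul_zero] at this
    exact dist_le_zero.1 this
  have hlip : LipschitzOnWith K (Function.invFunOn f S) (f '' S) := by
    refine LipschitzOnWith.of_dist_le_mul ?_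
    rintro _ ⟨y, hy, rfl⟩ _ ⟨z, hz, rfl⟩
    rw [hinj.leftInvOn_invFunOn hy, hinj.leftInvOn_invFunOn hz]
    exact h y hy z hz
  have himg : Function.invFunOn f S '' (f '' S) = S := hinj.invFunOn_image subset_rfl
  have key := hlip.hausdorffMeasure_image_le (d := (n : ℝ)) (by positivity)
  rw [himg] at key
  have hH : (μH[(n : ℝ)] : Measure (EuclideanSpace ℝ (Fin n))).IsAddHaarMeasure := by
    simpa using isAddHaarMeasure_hausdorffMeasure (E := EuclideanSpace ℝ (Fin n))
  rw [Measure.isAddLeftInvariant_eq_smul (volume : Measure (EuclideanSpace ℝ (Fin n))) μH[(n : ℝ)]]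
  simp only [Measure.smul_apply, ENNReal.smul_def, smul_eq_mul]
  rw [mul_left_comm]
  gcongr

section GraphClosure

variable {n : ℕ} {f : EuclideanSpace ℝ (Fin n) → EuclideanSpace ℝ (Fin n)}
  {A B T : Set (EuclideanSpace ℝ (Fin n))} {x : EuclideanSpace ℝ (Fin n)}
  {L : EuclideanSpace ℝ (Fin n) →L[ℝ] EuclideanSpace ℝ (Fin n)}

/-- The points over which the graph of `f` lies in the closure of the graph of `f` over `A`. -/
def graphClosure (f : EuclideanSpace ℝ (Fin n) → EuclideanSpace ℝ (Fin n))
    (A : Set (EuclideanSpace ℝ (Fin n))) : Set (EuclideanSpace ℝ (Fin n)) :=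
  {x | ∀ ε > 0, ∃ y ∈ A, dist x y < ε ∧ dist (f x) (f y) < ε}

theorem subset_graphClosure : A ⊆ graphClosure f A :=
  fun x hx ε hε => ⟨x, hx, by simpa using hε, by simpa using hε⟩

/-- `f` is antilipschitz with constant `K` on `A` at scales below `ρ`. -/
def LocallyAntilipschitzOn (K ρ : ℝ) (f : EuclideanSpace ℝ (Fin n) → EuclideanSpace ℝ (Fin n))
    (A : Set (EuclideanSpace ℝ (Fin n))) : Prop :=
  ∀ y ∈ A, ∀ z ∈ A, dist y z < ρ → dist y z ≤ K * dist (f y) (f z)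

theorem LocallyAntilipschitzOn.graphClosure {K ρ : ℝ} (hK : 0 ≤ K)
    (h : LocallyAntilipschitzOn K ρ f A) : LocallyAntilipschitzOn K ρ f (graphClosure f A) := by
  intro x hx x' hx' hd
  by_contra! hlt
  obtain ⟨ε, hε, h₁, h₂⟩ : ∃ ε > 0, dist x x' + 2 * ε < ρ ∧
      K * dist (f x) (f x') + (2 * K + 2) * ε < dist x x' := by
    have t₁ : Tendsto (fun ε : ℝ => dist x x' + 2 * ε) (𝓝[>] 0) (𝓝 (dist x x' + 2 * 0)) :=
      (Continuous.tendsto (by fun_prop) 0).mono_left nhdsWithin_le_nhds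
    have t₂ : Tendsto (fun ε : ℝ => K * dist (f x) (f x') + (2 * K + 2) * ε) (𝓝[>] 0)
        (𝓝 (K * dist (f x) (f x') + (2 * K + 2) * 0)) :=
      (Continuous.tendsto (by fun_prop) 0).mono_left nhdsWithin_le_nhds
    obtain ⟨ε, hε, h₁, h₂⟩ := (eventually_mem_nhdsWithin.and
      ((t₁.eventually_lt_const (by simpa using hd)).and
        (t₂.eventually_lt_const (by simpa using hlt)))).exists
    exact ⟨ε, hε, h₁, h₂⟩
  obtain ⟨y, hy, hxy, hfy⟩ := hx ε hε
  obtain ⟨y', hy', hxy', hfy'⟩ := hx' ε hε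
  have e₁ := dist_triangle4 y x x' y'
  have e₂ := dist_triangle4 x y y' x'
  have e₃ := dist_triangle4 (f y) (f x) (f x') (f y')
  rw [dist_comm y x] at e₁
  rw [dist_comm y' x'] at e₂
  rw [dist_comm (f y) (f x)] at e₃
  have e₄ := h y hy y' hy' (by linarith)
  have e₅ : K * dist (f y) (f y') ≤ K * (dist (f x) (f x') + 2 * ε) := by
    gcongr
    linarith
  linarith

theorem ApproxDiffAt.thinAt_dist (h : ApproxDiffAt f L x) {ε : ℝ} (hε : 0 < ε) :
    ThinAt {y | (‖L‖ + ε) * dist y x < dist (f y) (f x)} x := by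
  refine (h.thinAt hε).mono fun y hy => ?_
  simp only [Set.mem_ofPred_eq, dist_eq_norm] at hy ⊢
  have h₁ := L.le_opNorm (y - x)
  have h₂ := norm_sub_norm_le (f y - f x) (L (y - x))
  linarith

theorem ApproxDiffAt.mem_graphClosure (h : ApproxDiffAt f L x)
    (hA : ThinAt (toMeasurable volume A)ᶜ x) : x ∈ graphClosure f A := by
  by_contra hx
  simp only [graphClosure, Set.mem_ofPred_eq, not_forall, not_exists, not_and, not_lt] at hx
  obtain ⟨ε, hε, hx⟩ := hx
  have hc : 0 < ‖L‖ + 1 := by positivity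
  have hthin : ThinAt A x := by
    refine (h.thinAt_dist one_pos).mono_local (lt_min hε (div_pos hε hc)) ?_
    rintro y ⟨hy, hyx⟩
    rw [mem_ball, lt_min_iff, lt_div_iff₀ hc] at hyx
    have := hx y hy (by rw [dist_comm]; exact hyx.1)
    rw [dist_comm (f x)] at this
    simp only [Set.mem_ofPred_eq]
    linarith
  have := hthin.toMeasurable_set.union hA
  rw [Set.union_compl_self] at this
  exact not_thinAt_univ this

theorem ae_thinAt_compl_graphClosure {U : Set (EuclideanSpace ℝ (Fin n))} (hU : IsOpen U)
    (hf : ∀ᵐ x ∂volume, x ∈ U → ∃ L, ApproxDiffAt f L x) (A : Set (EuclideanSpace ℝ (Fin n))) :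
    ∀ᵐ x ∂volume, x ∈ U → x ∈ A → ThinAt (graphClosure f A)ᶜ x := by
  have hae := ae_thinAt_compl_toMeasurable A
  have hsub : ∀ᵐ x ∂volume, x ∈ U → x ∈ toMeasurable volume A → x ∈ graphClosure f A := by
    filter_upwards [hf, hae] with x h₁ h₂ hxU hxA
    obtain ⟨L, hL⟩ := h₁ hxU
    exact hL.mem_graphClosure (h₂ hxA)
  filter_upwards [hae] with x hx hxU hxA
  refine ((hx (subset_toMeasurable _ _ hxA)).union ((hU.thinAt_compl hxU).union
    (thinAt_of_volume_eq_zero (ae_iff.1 hsub)))).mono fun y hy => ?_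
  by_cases h₁ : y ∈ toMeasurable volume A
  · by_cases h₂ : y ∈ U
    · exact .inr (.inr fun h => hy (h h₂ h₁))
    · exact .inr (.inl h₂)
  · exact .inl h₁

theorem LocallyAntilipschitzOn.volume_inter_preimage_eq_zero {K ρ : ℝ} (hK : 0 ≤ K) (hρ : 0 < ρ)
    (h : LocallyAntilipschitzOn K ρ f A) (hT : volume T = 0) : volume (A ∩ f ⁻¹' T) = 0 := by
  obtain ⟨C, -, hC⟩ := exists_volume_le_mul_volume_image n ⟨K, hK⟩
  refine measure_null_of_locally_null _ fun x _ =>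
    ⟨_, inter_mem_nhdsWithin _ (ball_mem_nhds x (half_pos hρ)), ?_⟩
  refine le_antisymm ((hC f _ ?_).trans ?_) zero_le
  · rintro y ⟨⟨hy, -⟩, hyx⟩ z ⟨⟨hz, -⟩, hzx⟩
    refine h y hy z hz ?_
    have := dist_triangle_right y z x
    rw [mem_ball] at hyx hzx
    linarith
  · rw [measure_mono_null _ hT, mul_zero]
    rintro _ ⟨y, ⟨⟨-, hy⟩, -⟩, rfl⟩
    exact hy

theorem ThinAt.inter_preimage (hT : ThinAt T (f x)) {K ρ M : ℝ} (hK : 0 ≤ K) (hρ : 0 < ρ)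
    (hM : 0 < M) (h : LocallyAntilipschitzOn K ρ f A) :
    ThinAt (A ∩ f ⁻¹' T ∩ {y | dist (f y) (f x) ≤ M * dist y x}) x := by
  obtain ⟨C, hCtop, hC⟩ := exists_volume_le_mul_volume_image n ⟨K, hK⟩
  intro η hη
  have hD : C * ENNReal.ofReal (M ^ n) + 1 ≠ ∞ :=
    ENNReal.add_ne_top.2 ⟨ENNReal.mul_ne_top hCtop ENNReal.ofReal_ne_top, ENNReal.one_ne_top⟩
  have hlim : Tendsto (fun r : ℝ => M * r) (𝓝[>] 0) (𝓝[>] 0) := by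
    refine tendsto_nhdsWithin_iff.2 ⟨?_, ?_⟩
    · have : Tendsto (fun r : ℝ => M * r) (𝓝 0) (𝓝 (M * 0)) :=
        Continuous.tendsto (by fun_prop) 0
      rw [mul_zero] at this
      exact this.mono_left nhdsWithin_le_nhds
    · filter_upwards [self_mem_nhdsWithin] with r hr using mul_pos hM hr
  filter_upwards [hlim.eventually (hT _ (ENNReal.div_pos hη.ne' hD)),
    Ioo_mem_nhdsGT (half_pos hρ)] with r hr hrρ
  calc _ ≤ C * volume (f '' (A ∩ f ⁻¹' T ∩ {y | dist (f y) (f x) ≤ M * dist y x} ∩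
        closedBall x r)) := by
        refine hC f _ ?_
        rintro y ⟨⟨⟨hy, -⟩, -⟩, hyx⟩ z ⟨⟨⟨hz, -⟩, -⟩, hzx⟩
        refine h y hy z hz ?_
        have := dist_triangle_right y z x
        rw [mem_closedBall] at hyx hzx
        linarith [hrρ.2]
    _ ≤ C * volume (T ∩ closedBall (f x) (M * r)) := by
        gcongr
        rintro _ ⟨y, ⟨⟨⟨-, hy⟩, hyM⟩, hyx⟩, rfl⟩
        exact ⟨hy, (Set.mem_ofPred_eq ▸ hyM).trans (by gcongr; exact hyx)⟩
    _ ≤ C * (η / (C * ENNReal.ofReal (M ^ n) + 1) * volume (closedBall (f x) (M * r))) := by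
        gcongr
    _ = C * ENNReal.ofReal (M ^ n) * (η / (C * ENNReal.ofReal (M ^ n) + 1)) *
          volume (closedBall x r) := by
        rw [volume_closedBall_mul (x := x) hM.le hrρ.1.le]
        ring
    _ ≤ (C * ENNReal.ofReal (M ^ n) + 1) * (η / (C * ENNReal.ofReal (M ^ n) + 1)) *
          volume (closedBall x r) := by
        gcongr
        exact le_self_add
    _ ≤ η * volume (closedBall x r) := by
        gcongr
        exact ENNReal.mul_div_le

end GraphClosure

section Decomposition

variable {n : ℕ} {f : EuclideanSpace ℝ (Fin n) → EuclideanSpace ℝ (Fin n)}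
  {x : EuclideanSpace ℝ (Fin n)} {L : EuclideanSpace ℝ (Fin n) →L[ℝ] EuclideanSpace ℝ (Fin n)}

/-- The points `z` at which the increment of `f` from `x` is not comparable, up to the factor `c`,
with the increment of the argument. -/
def distortedSet (f : EuclideanSpace ℝ (Fin n) → EuclideanSpace ℝ (Fin n)) (c : ℝ)
    (x : EuclideanSpace ℝ (Fin n)) : Set (EuclideanSpace ℝ (Fin n)) :=
  {z | c * dist (f z) (f x) < dist z x ∨ c * dist z x < dist (f z) (f x)}

/-- The points `x` such that, at every scale below `ρ`, the proportion of points distorted by the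
factor `c` with respect to `x` is at most `η`. -/
def mildlyDistortedSet (f : EuclideanSpace ℝ (Fin n) → EuclideanSpace ℝ (Fin n)) (c : ℝ)
    (η : ℝ≥0∞) (ρ : ℝ) : Set (EuclideanSpace ℝ (Fin n)) :=
  {x | ∀ r ∈ Set.Ioo 0 ρ,
    volume (distortedSet f c x ∩ closedBall x r) ≤ η * volume (closedBall x r)}

theorem ApproxDiffAt.exists_thinAt_distortedSet (h : ApproxDiffAt f L x) (hL : L.det ≠ 0) :
    ∃ j : ℕ, ThinAt (distortedSet f (j + 1) x) x := by
  have hker : LinearMap.ker (L : EuclideanSpace ℝ (Fin n) →ₗ[ℝ] EuclideanSpace ℝ (Fin n)) = ⊥ :=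
    (LinearMap.equivOfDetNeZero _ hL).ker
  obtain ⟨K, hK0, hK⟩ := LinearMap.exists_antilipschitzWith _ hker
  have hK0' : (0 : ℝ) < K := hK0
  have hanti : ∀ v, ‖v‖ ≤ K * ‖L v‖ := fun v => by
    simpa using hK.le_mul_dist v 0
  set ε : ℝ := 1 / (2 * K)
  have hε : 0 < ε := by positivity
  obtain ⟨j, hj⟩ := exists_nat_ge (max (2 * (K : ℝ)) (‖L‖ + ε))
  have hj₁ := (le_max_left _ _).trans hj
  have hj₂ := (le_max_right _ _).trans hj
  refine ⟨j, ((h.thinAt hε).union (h.thinAt_dist hε)).mono ?_⟩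
  intro z hz
  by_contra hgood
  simp only [Set.mem_union, Set.mem_ofPred_eq, not_or, not_lt] at hgood
  obtain ⟨hg₁, hg₂⟩ := hgood
  rcases hz with hz | hz
  · rw [dist_eq_norm, dist_eq_norm] at hz
    have h₁ := hanti (z - x)
    have h₂ := norm_sub_norm_le (L (z - x)) (f z - f x)
    rw [norm_sub_rev (L (z - x))] at h₂
    have h₃ : (K : ℝ) * ‖L (z - x)‖ ≤ K * (‖f z - f x‖ + ε * ‖z - x‖) := by
      gcongr
      linarith
    have h₄ : (K : ℝ) * (ε * ‖z - x‖) = ‖z - x‖ / 2 := by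
      simp only [ε]
      field_simp
    have h₅ : 2 * K * ‖f z - f x‖ ≤ (j + 1) * ‖f z - f x‖ := by
      gcongr
      linarith
    linarith
  · have h₁ : (‖L‖ + ε) * dist z x ≤ (j + 1) * dist z x :=
      mul_le_mul_of_nonneg_right (by linarith) dist_nonneg
    linarith

theorem ThinAt.exists_mem_mildlyDistortedSet {c : ℝ} (h : ThinAt (distortedSet f c x) x)
    {η : ℝ≥0∞} (hη : 0 < η) : ∃ i : ℕ, x ∈ mildlyDistortedSet f c η (1 / (i + 1)) := by
  obtain ⟨ρ, hρ, h⟩ := mem_nhdsGT_iff_exists_Ioo_subset.1 (h η hη)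
  obtain ⟨i, hi⟩ := exists_nat_one_div_lt (Set.mem_Ioi.1 hρ)
  exact ⟨i, fun r hr => h ⟨hr.1, hr.2.trans hi⟩⟩

theorem locallyAntilipschitzOn_mildlyDistortedSet {c : ℝ} (hc : 1 ≤ c) {η : ℝ≥0∞}
    (hη : η * (1 + ENNReal.ofReal ((8 * c ^ 2) ^ n)) < 1) (ρ : ℝ) :
    LocallyAntilipschitzOn (2 * c) (ρ / 2) f (mildlyDistortedSet f c η ρ) := by
  intro x hx y hy hxy
  rcases eq_or_ne x y with rfl | hne
  · simp
  have hc0 : 0 < c := one_pos.trans_le hc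
  set d := dist x y
  have hd : 0 < d := dist_pos.2 hne
  set r := d / (4 * c ^ 2) with hr
  have hr0 : 0 < r := by positivity
  have hrd : 4 * c ^ 2 * r = d := by
    rw [hr]
    field_simp
  have hc2 : 1 ≤ c ^ 2 := one_le_pow₀ hc
  have hrd' : 4 * r ≤ d := by nlinarith
  have hcr : 4 * (c * r) ≤ d / c := by
    rw [le_div_iff₀ hc0]
    linarith
  obtain ⟨z, hz, hzxy⟩ : ∃ z ∈ closedBall y r, z ∉ distortedSet f c x ∪ distortedSet f c y := by
    by_contra! hcover
    have hv0 := (volume_closedBall_pos_of_pos (x := y) hr0).ne'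
    have hvtop : volume (closedBall y r) ≠ ∞ := measure_closedBall_lt_top.ne
    have : volume (closedBall y r) < 1 * volume (closedBall y r) := by
      calc volume (closedBall y r)
          ≤ volume (distortedSet f c y ∩ closedBall y r ∪
              distortedSet f c x ∩ closedBall x (8 * c ^ 2 * r)) := by
            refine measure_mono fun z hz => ?_
            rcases hcover z hz with h | h
            · refine .inr ⟨h, ?_⟩
              rw [mem_closedBall] at hz ⊢
              have := dist_triangle_right z x y
              have := dist_comm x y
              linarith
            · exact .inl ⟨h, hz⟩
        _ ≤ η * volume (closedBall y r) + η * volume (closedBall x (8 * c ^ 2 * r)) :=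
            (measure_union_le _ _).trans
              (add_le_add (hy r ⟨hr0, by linarith⟩) (hx _ ⟨by positivity, by linarith⟩))
        _ = η * (1 + ENNReal.ofReal ((8 * c ^ 2) ^ n)) * volume (closedBall y r) := by
            rw [volume_closedBall_mul (x := y) (by positivity) hr0.le]
            ring
        _ < 1 * volume (closedBall y r) := by gcongr
    simp at this
  simp only [distortedSet, Set.mem_union, Set.mem_ofPred_eq, not_or, not_lt] at hzxy
  obtain ⟨⟨h₁, -⟩, -, h₂⟩ := hzxy
  rw [mem_closedBall] at hz
  have e₁ := dist_triangle_left x y z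
  have e₂ := dist_triangle_right (f z) (f x) (f y)
  have e₃ : c * dist (f z) (f x) ≤ c * (c * r + dist (f x) (f y)) := by
    gcongr
    have : c * dist z y ≤ c * r := by gcongr
    linarith
  linarith

end Decomposition

section ChainRule

variable {n m : ℕ} {f : EuclideanSpace ℝ (Fin n) → EuclideanSpace ℝ (Fin n)}
  {g : EuclideanSpace ℝ (Fin n) → EuclideanSpace ℝ (Fin m)}
  {A : Set (EuclideanSpace ℝ (Fin n))} {x : EuclideanSpace ℝ (Fin n)}
  {L : EuclideanSpace ℝ (Fin n) →L[ℝ] EuclideanSpace ℝ (Fin n)}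
  {M : EuclideanSpace ℝ (Fin n) →L[ℝ] EuclideanSpace ℝ (Fin m)}

theorem ApproxDiffAt.comp_of_locallyAntilipschitzOn (hg : ApproxDiffAt g M (f x))
    (hf : ApproxDiffAt f L x) {K ρ : ℝ} (hK : 0 ≤ K) (hρ : 0 < ρ)
    (hA : LocallyAntilipschitzOn K ρ f A) (hAx : ThinAt Aᶜ x) :
    ApproxDiffAt (g ∘ f) (M.comp L) x := by
  have hthinf := hf.thinAt_dist one_pos
  obtain ⟨E, hE, hEx, hEt⟩ := hf
  obtain ⟨E', hE', hE'x, hE't⟩ := hg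
  set c := ‖L‖ + 1
  have hc : 0 < c := by positivity
  obtain ⟨D, hD, hDx, hDsub⟩ := ((hAx.union hthinf).union ((hEx.thinAt_compl hE).union
    ((hE'x.thinAt_compl hE').inter_preimage hK hρ hc hA))).exists_measurable_densityPt
  refine ⟨D, hD, hDx, ?_⟩
  have hmem : ∀ y ∈ D, y ∈ E ∧ f y ∈ E' ∧ dist (f y) (f x) ≤ c * dist y x := by
    intro y hy
    have := hDsub hy
    simp only [Set.mem_compl_iff, Set.mem_union, Set.mem_inter_iff, Set.mem_preimage,
      Set.mem_ofPred_eq, not_or, not_lt] at this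
    tauto
  rw [Metric.tendsto_nhds]
  intro ε hε
  set δ := ε / (2 * (c + ‖M‖ + 1))
  have hδ : 0 < δ := by positivity
  have hδε : (c + ‖M‖) * δ < ε := by
    have : 2 * (c + ‖M‖ + 1) * δ = ε := by
      simp only [δ]
      field_simp
    nlinarith [norm_nonneg M]
  have ev₁ := hEt.eventually_lt_const hδ
  have ev₂ := hE't.eventually_lt_const hδ
  rw [eventually_nhdsWithin_iff, Metric.eventually_nhds_iff] at ev₁ ev₂
  obtain ⟨r₁, hr₁, ev₁⟩ := ev₁
  obtain ⟨r₂, hr₂, ev₂⟩ := ev₂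
  rw [eventually_nhdsWithin_iff, Metric.eventually_nhds_iff]
  refine ⟨min r₁ (r₂ / c), lt_min hr₁ (div_pos hr₂ hc), fun y hy ⟨hyD, hyx⟩ => ?_⟩
  rw [lt_min_iff, lt_div_iff₀ hc] at hy
  obtain ⟨hyE, hyE', hyc⟩ := hmem y hyD
  have hpos : 0 < ‖y - x‖ := norm_pos_iff.2 (sub_ne_zero.2 hyx)
  have h₁ := ev₁ hy.1 ⟨hyE, hyx⟩
  rw [div_lt_iff₀ hpos] at h₁
  have h₂ : ‖g (f y) - g (f x) - M (f y - f x)‖ ≤ δ * ‖f y - f x‖ := by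
    rcases eq_or_ne (f y) (f x) with heq | hne
    · simp [heq]
    · have := ev₂ (by linarith) ⟨hyE', hne⟩
      exact ((div_lt_iff₀ (norm_pos_iff.2 (sub_ne_zero.2 hne))).1 this).le
  rw [dist_eq_norm, dist_eq_norm] at hyc
  rw [dist_zero_right, Real.norm_of_nonneg (by positivity), div_lt_iff₀ hpos]
  calc ‖(g ∘ f) y - (g ∘ f) x - (M.comp L) (y - x)‖
      = ‖(g (f y) - g (f x) - M (f y - f x)) + M (f y - f x - L (y - x))‖ := by
        congr 1
        simp only [Function.comp_apply, ContinuousLinearMap.comp_apply, map_sub]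
        abel
    _ ≤ δ * ‖f y - f x‖ + ‖M‖ * ‖f y - f x - L (y - x)‖ :=
        (norm_add_le _ _).trans (add_le_add h₂ (M.le_opNorm _))
    _ ≤ δ * (c * ‖y - x‖) + ‖M‖ * (δ * ‖y - x‖) := by gcongr
    _ = (c + ‖M‖) * δ * ‖y - x‖ := by ring
    _ < ε * ‖y - x‖ := by gcongr

end ChainRule

/-- Chain rule for a.e. approximately differentiable maps: if `f : U → ℝⁿ` is a.e.
approximately differentiable with a.e. nonvanishing Jacobian, `f(U) ⊆ V` and `g : V → ℝᵐ`
is a.e. approximately differentiable, then `g ∘ f` is a.e. approximately differentiable on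
`U` with derivative `D_a g(f(x)) ∘ D_a f(x)`. -/
theorem stmt17 {n m : ℕ} (U V : Set (EuclideanSpace ℝ (Fin n)))
    (hU : IsOpen U) (hV : IsOpen V)
    (f : EuclideanSpace ℝ (Fin n) → EuclideanSpace ℝ (Fin n))
    (g : EuclideanSpace ℝ (Fin n) → EuclideanSpace ℝ (Fin m))
    (hmaps : Set.MapsTo f U V)
    (hf : ∀ᵐ x ∂volume, x ∈ U → ∃ L, ApproxDiffAt f L x ∧ L.det ≠ 0)
    (hg : ∀ᵐ y ∂volume, y ∈ V → ∃ M, ApproxDiffAt g M y) :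
    ∀ᵐ x ∂volume, x ∈ U →
      ∃ (L : EuclideanSpace ℝ (Fin n) →L[ℝ] EuclideanSpace ℝ (Fin n))
        (M : EuclideanSpace ℝ (Fin n) →L[ℝ] EuclideanSpace ℝ (Fin m)),
        ApproxDiffAt f L x ∧ ApproxDiffAt g M (f x) ∧
        ApproxDiffAt (g ∘ f) (M.comp L) x := by
  obtain ⟨η, hη0, hη⟩ : ∃ η : ℕ → ℝ≥0∞, (∀ j, 0 < η j) ∧
      ∀ j : ℕ, η j * (1 + ENNReal.ofReal ((8 * ((j : ℝ) + 1) ^ 2) ^ n)) < 1 := by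
    have (j : ℕ) : ∃ η : ℝ≥0∞, 0 < η ∧
        η * (1 + ENNReal.ofReal ((8 * ((j : ℝ) + 1) ^ 2) ^ n)) < 1 := by
      have ht : 1 + ENNReal.ofReal ((8 * ((j : ℝ) + 1) ^ 2) ^ n) ≠ ∞ :=
        ENNReal.add_ne_top.2 ⟨ENNReal.one_ne_top, ENNReal.ofReal_ne_top⟩
      have h0 : 1 + ENNReal.ofReal ((8 * ((j : ℝ) + 1) ^ 2) ^ n) ≠ 0 := by simp
      refine ⟨2⁻¹ * (1 + ENNReal.ofReal ((8 * ((j : ℝ) + 1) ^ 2) ^ n))⁻¹,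
        ENNReal.mul_pos (by simp) (ENNReal.inv_ne_zero.2 ht), ?_⟩
      rw [mul_assoc, ENNReal.inv_mul_cancel h0 ht, mul_one]
      simp
    choose η h₁ h₂ using this
    exact ⟨η, h₁, h₂⟩
  set A : ℕ → ℕ → Set (EuclideanSpace ℝ (Fin n)) := fun j i =>
    mildlyDistortedSet f (j + 1) (η j) (1 / (i + 1))
  have hA (j i : ℕ) : LocallyAntilipschitzOn (2 * (j + 1)) (1 / (i + 1) / 2) f
      (graphClosure f (A j i)) :=
    (locallyAntilipschitzOn_mildlyDistortedSet (by simp) (hη j) _).graphClosure (by positivity)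
  have hthin : ∀ᵐ x ∂volume, ∀ j i, x ∈ U → x ∈ A j i → ThinAt (graphClosure f (A j i))ᶜ x := by
    refine ae_all_iff.2 fun j => ae_all_iff.2 fun i => ae_thinAt_compl_graphClosure hU ?_ _
    filter_upwards [hf] with x hx hxU
    obtain ⟨L, hL, -⟩ := hx hxU
    exact ⟨L, hL⟩
  have hnull : ∀ᵐ x ∂volume, ∀ j i, x ∈ graphClosure f (A j i) →
      f x ∈ V → ∃ M, ApproxDiffAt g M (f x) := by
    refine ae_all_iff.2 fun j => ae_all_iff.2 fun i => ?_
    have := (hA j i).volume_inter_preimage_eq_zero (by positivity) (by positivity) (ae_iff.1 hg)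
    refine ae_iff.2 (measure_mono_null (fun x hx => ?_) this)
    exact Classical.not_imp.1 hx
  filter_upwards [hf, hthin, hnull] with x hfx hthinx hnullx hxU
  obtain ⟨L, hL, hdet⟩ := hfx hxU
  obtain ⟨j, hj⟩ := hL.exists_thinAt_distortedSet hdet
  obtain ⟨i, hi⟩ := hj.exists_mem_mildlyDistortedSet (hη0 j)
  obtain ⟨M, hM⟩ := hnullx j i (subset_graphClosure hi) (hmaps hxU)
  exact ⟨L, M, hL, hM, hM.comp_of_locallyAntilipschitzOn hL (by positivity) (by positivity)
    (hA j i) (hthinx j i hxU hi)⟩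
end
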